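/- Disjunction property for disjuncts with disjoint propositional symbols: if F ∨ G is derivable in LJ+ and F and G have no propositional symbols in common, then F is derivable in LJ+ or G is derivable in LJ+. More generally, if F ∨ G is derivable in LJ+ and every propositional symbol occurring in both F and G has only positive occurrences or only negative occurrences in F ∨ G, then F or G is derivable in LJ+. -/

import Mathlib

/-! Syntax of first-order formulas. Atoms are either propositional symbols
(arity-0) or predicate symbols of arity ≥ 1 applied to variables.
There are no function symbols or object constants: terms are variables (ℕ). -/

inductive Formula : Type
  | prop : ℕ → Formula                      -- propositional symbol
  | pred : ℕ → ℕ → List ℕ → Formula         -- predicate symbol (arity ≥ 1) applied to variables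
  | top : Formula
  | bot : Formula
  | and : Formula → Formula → Formula
  | or : Formula → Formula → Formula
  | imp : Formula → Formula → Formula
  | neg : Formula → Formula
  | all : ℕ → Formula → Formula             -- ∀x A
  | ex : ℕ → Formula → Formula              -- ∃x A
  deriving DecidableEq

namespace Formula

/-- Free variables of a formula. -/
def fv : Formula → Finset ℕ
  | prop _ => ∅
  | pred _ x xs => insert x xs.toFinset
  | top => ∅
  | bot => ∅
  | and A B => fv A ∪ fv B
  | or A B => fv A ∪ fv B
  | imp A B => fv A ∪ fv B
  | neg A => fv A
  | all x A => (fv A).erase x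
  | ex x A => (fv A).erase x

/-- All variables occurring in a formula (free or bound, including binders). -/
def vars : Formula → Finset ℕ
  | prop _ => ∅
  | pred _ x xs => insert x xs.toFinset
  | top => ∅
  | bot => ∅
  | and A B => vars A ∪ vars B
  | or A B => vars A ∪ vars B
  | imp A B => vars A ∪ vars B
  | neg A => vars A
  | all x A => insert x (vars A)
  | ex x A => insert x (vars A)

/-- Binder variables of a formula. -/
def bv : Formula → Finset ℕ
  | prop _ => ∅
  | pred _ _ _ => ∅
  | top => ∅
  | bot => ∅
  | and A B => bv A ∪ bv B
  | or A B => bv A ∪ bv B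
  | imp A B => bv A ∪ bv B
  | neg A => bv A
  | all x A => insert x (bv A)
  | ex x A => insert x (bv A)

/-- `rename a b F` replaces the free occurrences of variable `a` in `F` by variable `b`.
`F.rename a b` plays the role of "F(b)" when `F` is "F(a)". -/
def rename (a b : ℕ) : Formula → Formula
  | prop n => prop n
  | pred n x xs =>
      pred n (if x = a then b else x) (xs.map fun y => if y = a then b else y)
  | top => top
  | bot => bot
  | and A B => and (rename a b A) (rename a b B)
  | or A B => or (rename a b A) (rename a b B)
  | imp A B => imp (rename a b A) (rename a b B)
  | neg A => neg (rename a b A)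
  | all x A => if x = a then all x A else all x (rename a b A)
  | ex x A => if x = a then ex x A else ex x (rename a b A)

/-- A formula is propositional if it is built from propositional symbols (and ⊤, ⊥)
by the propositional connectives only. -/
def Propositional : Formula → Prop
  | prop _ => True
  | pred _ _ _ => False
  | top => True
  | bot => True
  | and A B => Propositional A ∧ Propositional B
  | or A B => Propositional A ∧ Propositional B
  | imp A B => Propositional A ∧ Propositional B
  | neg A => Propositional A
  | all _ _ => False
  | ex _ _ => False

/-- A formula is purely predicate if all its atoms are built from predicate symbols
of arity > 0 (it contains no propositional symbols). -/
def PurelyPredicate : Formula → Prop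
  | prop _ => False
  | pred _ _ _ => True
  | top => True
  | bot => True
  | and A B => PurelyPredicate A ∧ PurelyPredicate B
  | or A B => PurelyPredicate A ∧ PurelyPredicate B
  | imp A B => PurelyPredicate A ∧ PurelyPredicate B
  | neg A => PurelyPredicate A
  | all _ A => PurelyPredicate A
  | ex _ A => PurelyPredicate A

/-- Truth-table evaluation of a propositional formula under assignment `v`. -/
def evalP (v : ℕ → Bool) : Formula → Bool
  | prop n => v n
  | pred _ _ _ => false
  | top => true
  | bot => false
  | and A B => evalP v A && evalP v B
  | or A B => evalP v A || evalP v B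
  | imp A B => !evalP v A || evalP v B
  | neg A => !evalP v A
  | all _ _ => false
  | ex _ _ => false

/-- A (propositional) formula is classically valid / derivable in classical
propositional logic if it is true under every truth-value assignment. -/
def ClassicallyValid (A : Formula) : Prop := ∀ v : ℕ → Bool, evalP v A = true

/-- `substProp R C A` replaces all occurrences of the propositional symbol `R`
in `A` by the formula `C` (written A{R|C} in the paper). -/
def substProp (R : ℕ) (C : Formula) : Formula → Formula
  | prop n => if n = R then C else prop n
  | pred n x xs => pred n x xs
  | top => top
  | bot => bot
  | and A B => and (substProp R C A) (substProp R C B)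
  | or A B => or (substProp R C A) (substProp R C B)
  | imp A B => imp (substProp R C A) (substProp R C B)
  | neg A => neg (substProp R C A)
  | all x A => all x (substProp R C A)
  | ex x A => ex x (substProp R C A)

/-- `polProps b F` is the set of propositional symbols having an occurrence of
polarity `b` in `F` (`true` = positive, `false` = negative); `F` itself is a
positive occurrence, ∨ & quantifiers preserve polarity, ¬ flips it, and
`A ⊃ B` flips the polarity of `A` and preserves that of `B`. -/
def polProps : Bool → Formula → Finset ℕ
  | b, prop n => if b then {n} else ∅
  | _, pred _ _ _ => ∅
  | _, top => ∅
  | _, bot => ∅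
  | b, and A B => polProps b A ∪ polProps b B
  | b, or A B => polProps b A ∪ polProps b B
  | b, imp A B => polProps (!b) A ∪ polProps b B
  | b, neg A => polProps (!b) A
  | b, all _ A => polProps b A
  | b, ex _ A => polProps b A

/-- The propositional symbols occurring in a formula. -/
def propSyms (F : Formula) : Finset ℕ := polProps true F ∪ polProps false F

/-- A formula is unipolar if the occurrences of every propositional symbol in it
are either all positive or all negative. -/
def Unipolar (F : Formula) : Prop :=
  ∀ n : ℕ, ¬ (n ∈ polProps true F ∧ n ∈ polProps false F)

end Formula

/-- A sequent Γ ⊢ Λ: the antecedent is a finite sequence of formulas and the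
succedent contains at most one formula. -/
abbrev Sequent := List Formula × Option Formula

/-- Free variables of a list of formulas. -/
def fvList (Γ : List Formula) : Finset ℕ := Γ.foldr (fun A s => A.fv ∪ s) ∅

/-- Free variables of an optional succedent formula. -/
def fvOpt : Option Formula → Finset ℕ
  | none => ∅
  | some A => A.fv

/-- Inference rules (conclusion, list of premises) of Gentzen-style sequent calculi.
The flag `cut` enables the cut rule, the flag `neut` enables the neutralization
rule (restricted to propositional formulas `N`), and `lem` determines the class of
formulas `A` for which the axiom `⊢ A ∨ ¬A` is available. -/
inductive Rule (cut neut : Bool) (lem : Formula → Prop) : Sequent → List Sequent → Prop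
  | ax (A : Formula) : Rule cut neut lem ([A], some A) []
  | topR : Rule cut neut lem ([], some .top) []
  | botL : Rule cut neut lem ([.bot], none) []
  | thinL (A : Formula) (Γ : List Formula) (Λ : Option Formula) :
      Rule cut neut lem (A :: Γ, Λ) [(Γ, Λ)]
  | thinR (A : Formula) (Γ : List Formula) :
      Rule cut neut lem (Γ, some A) [(Γ, none)]
  | contr (A : Formula) (Γ : List Formula) (Λ : Option Formula) :
      Rule cut neut lem (A :: Γ, Λ) [(A :: A :: Γ, Λ)]
  | exch (Δ Γ : List Formula) (A B : Formula) (Λ : Option Formula) :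
      Rule cut neut lem (Δ ++ B :: A :: Γ, Λ) [(Δ ++ A :: B :: Γ, Λ)]
  | cut' (Γ Δ : List Formula) (C : Formula) (Λ : Option Formula) (hc : cut = true) :
      Rule cut neut lem (Γ ++ Δ, Λ) [(Γ, some C), (C :: Δ, Λ)]
  | andR (Γ : List Formula) (A B : Formula) :
      Rule cut neut lem (Γ, some (A.and B)) [(Γ, some A), (Γ, some B)]
  | andL1 (A B : Formula) (Γ : List Formula) (Λ : Option Formula) :
      Rule cut neut lem (A.and B :: Γ, Λ) [(A :: Γ, Λ)]
  | andL2 (A B : Formula) (Γ : List Formula) (Λ : Option Formula) :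
      Rule cut neut lem (A.and B :: Γ, Λ) [(B :: Γ, Λ)]
  | orL (A B : Formula) (Γ : List Formula) (Λ : Option Formula) :
      Rule cut neut lem (A.or B :: Γ, Λ) [(A :: Γ, Λ), (B :: Γ, Λ)]
  | orR1 (Γ : List Formula) (A B : Formula) :
      Rule cut neut lem (Γ, some (A.or B)) [(Γ, some A)]
  | orR2 (Γ : List Formula) (A B : Formula) :
      Rule cut neut lem (Γ, some (A.or B)) [(Γ, some B)]
  | negR (A : Formula) (Γ : List Formula) :
      Rule cut neut lem (Γ, some A.neg) [(A :: Γ, none)]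
  | negL (A : Formula) (Γ : List Formula) :
      Rule cut neut lem (A.neg :: Γ, none) [(Γ, some A)]
  | impR (A B : Formula) (Γ : List Formula) :
      Rule cut neut lem (Γ, some (A.imp B)) [(A :: Γ, some B)]
  | impL (A B : Formula) (Γ Δ : List Formula) (Λ : Option Formula) :
      Rule cut neut lem (A.imp B :: (Γ ++ Δ), Λ) [(Γ, some A), (B :: Δ, Λ)]
  | allR (Γ : List Formula) (x a : ℕ) (G : Formula)
      (ha : a ∉ fvList Γ ∪ (Formula.all x G).fv) (hv : a ∉ G.vars) :
      Rule cut neut lem (Γ, some (.all x G)) [(Γ, some (G.rename x a))]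
  | allL (x : ℕ) (G : Formula) (a : ℕ) (Γ : List Formula) (Λ : Option Formula)
      (hc : a = x ∨ a ∉ G.bv) :
      Rule cut neut lem (.all x G :: Γ, Λ) [(G.rename x a :: Γ, Λ)]
  | exR (Γ : List Formula) (x : ℕ) (G : Formula) (a : ℕ)
      (hc : a = x ∨ a ∉ G.bv) :
      Rule cut neut lem (Γ, some (.ex x G)) [(Γ, some (G.rename x a))]
  | exL (x : ℕ) (G : Formula) (a : ℕ) (Γ : List Formula) (Λ : Option Formula)
      (ha : a ∉ (fvList Γ ∪ (Formula.ex x G).fv) ∪ fvOpt Λ) (hv : a ∉ G.vars) :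
      Rule cut neut lem (.ex x G :: Γ, Λ) [(G.rename x a :: Γ, Λ)]
  | neut' (N : Formula) (Γ : List Formula) (Λ : Option Formula)
      (hn : neut = true) (hN : N.Propositional) :
      Rule cut neut lem (Γ, Λ) [(N :: Γ, Λ), (N.neg :: Γ, Λ)]
  | lemAx (A : Formula) (h : lem A) :
      Rule cut neut lem ([], some (A.or A.neg)) []

/-- Derivability from a set of rules. -/
inductive Derives (R : Sequent → List Sequent → Prop) : Sequent → Prop
  | step {s : Sequent} {ps : List Sequent} :
      R s ps → (∀ p ∈ ps, Derives R p) → Derives R s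

/-- No additional excluded-middle axioms. -/
def NoLem : Formula → Prop := fun _ => False

/-- LJ: Gentzen's intuitionistic sequent calculus. -/
def LJ : Sequent → Prop := Derives (Rule true false NoLem)

/-- LJ+: LJ extended with the neutralization rule. -/
def LJPlus : Sequent → Prop := Derives (Rule true true NoLem)

/-- Cut-free LJ+. -/
def LJPlusCF : Sequent → Prop := Derives (Rule false true NoLem)

/-- LJ extended with the axiom schema ⊢ A ∨ ¬A for every propositional symbol A. -/
def LJLemPropAtoms : Sequent → Prop :=
  Derives (Rule true false (fun A => ∃ n : ℕ, A = Formula.prop n))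

/-- LK: Gentzen's classical sequent calculus, presented equivalently as
LJ plus the axiom schema ⊢ A ∨ ¬A for arbitrary formulas A. -/
def LK : Sequent → Prop := Derives (Rule true false (fun _ => True))

/-- A formula is a theorem of LJ+ if the sequent ⊢ F is derivable. -/
def LJPlusThm (F : Formula) : Prop := LJPlus ([], some F)

def LJThm (F : Formula) : Prop := LJ ([], some F)

def LKThm (F : Formula) : Prop := LK ([], some F)

/-- Intuitionistic Kripke structures: a partially ordered set of nodes with
monotone nonempty domains and monotone valuations for propositional symbols
and for predicate symbols. -/
structure Kripke where
  W : Type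
  U : Type
  le : W → W → Prop
  le_refl : ∀ w, le w w
  le_trans : ∀ u v w, le u v → le v w → le u w
  le_antisymm : ∀ u v, le u v → le v u → u = v
  D : W → Set U
  D_ne : ∀ w, (D w).Nonempty
  D_mono : ∀ {w w'}, le w w' → D w ⊆ D w'
  TP : W → ℕ → Prop
  TQ : W → ℕ → List U → Prop
  TP_mono : ∀ {w w'}, le w w' → ∀ n, TP w n → TP w' n
  TQ_mono : ∀ {w w'}, le w w' → ∀ n ds, TQ w n ds → TQ w' n ds

/-- A constrained Kripke structure: for all nodes k ≤ k' and every propositional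
symbol Q, Q is in the valuation of k if and only if it is in the valuation of k'. -/
def Kripke.Constrained (K : Kripke) : Prop :=
  ∀ {w w' : K.W}, K.le w w' → ∀ n : ℕ, (K.TP w n ↔ K.TP w' n)

/-- The standard intuitionistic forcing relation (with an assignment σ of
domain elements to variables). -/
def Kripke.forces (K : Kripke) : K.W → (ℕ → K.U) → Formula → Prop
  | w, _, .prop n => K.TP w n
  | w, σ, .pred n x xs => K.TQ w n ((x :: xs).map σ)
  | _, _, .top => True
  | _, _, .bot => False
  | w, σ, .and A B => K.forces w σ A ∧ K.forces w σ B
  | w, σ, .or A B => K.forces w σ A ∨ K.forces w σ B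
  | w, σ, .imp A B => ∀ w', K.le w w' → K.forces w' σ A → K.forces w' σ B
  | w, σ, .neg A => ∀ w', K.le w w' → ¬ K.forces w' σ A
  | w, σ, .all x A => ∀ w', K.le w w' → ∀ d ∈ K.D w', K.forces w' (Function.update σ x d) A
  | w, σ, .ex x A => ∃ d ∈ K.D w, K.forces w (Function.update σ x d) A

/-- Validity of a sequent with respect to constrained Kripke structures:
at every node of every constrained Kripke structure (under every assignment into
the node's domain), either some antecedent formula is not forced, or the
succedent is nonempty and its formula is forced. -/
def SeqValid (s : Sequent) : Prop :=
  ∀ K : Kripke, K.Constrained → ∀ w : K.W, ∀ σ : ℕ → K.U, (∀ n, σ n ∈ K.D w) →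
    (∃ A ∈ s.1, ¬ K.forces w σ A) ∨ (∃ A, s.2 = some A ∧ K.forces w σ A)

namespace Formula

lemma fv_subset_vars (A : Formula) : A.fv ⊆ A.vars := by
  induction A <;> simp only [fv, vars] <;> grind

lemma bv_subset_vars (A : Formula) : A.bv ⊆ A.vars := by
  induction A <;> simp only [bv, vars] <;> grind

lemma Propositional.fv_eq {A : Formula} (h : A.Propositional) : A.fv = ∅ := by
  induction A <;> simp_all [fv, Propositional]

lemma Propositional.bv_eq {A : Formula} (h : A.Propositional) : A.bv = ∅ := by
  induction A <;> simp_all [bv, Propositional]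

lemma rename_self (a : ℕ) (A : Formula) : A.rename a a = A := by
  have h : (fun y => if y = a then a else y) = id := by
    funext y
    split_ifs with hy <;> simp [hy]
  induction A <;> simp_all [rename]

/-- The number of logical symbols of a formula. -/
def size : Formula → ℕ
  | prop _ => 0
  | pred _ _ _ => 0
  | top => 0
  | bot => 0
  | and A B => size A + size B + 1
  | or A B => size A + size B + 1
  | imp A B => size A + size B + 1
  | neg A => size A + 1
  | all _ A => size A + 1
  | ex _ A => size A + 1

lemma size_rename (x a : ℕ) (A : Formula) : (A.rename x a).size = A.size := by
  induction A <;> simp only [rename] <;> (try split_ifs) <;> simp_all [size]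

lemma fv_rename {x a : ℕ} {A : Formula} (h : a ∉ A.bv) :
    (A.rename x a).fv = A.fv.image (fun y => if y = x then a else y) := by
  induction A with
  | pred n y ys => ext z; simp [rename, fv]
  | all z A ih | ex z A ih =>
    simp only [bv, Finset.mem_insert, not_or] at h
    simp only [rename]
    split_ifs with hz
    · subst hz
      ext w
      simp only [fv, Finset.mem_erase, Finset.mem_image]
      grind
    · ext w
      simp only [fv, ih h.2, Finset.mem_erase, Finset.mem_image]
      grind
  | _ => simp_all [rename, fv, bv, Finset.image_union]

/-- The least number that is at least `k` and exceeds all elements of `S`. -/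
def freshVar (k : ℕ) (S : Finset ℕ) : ℕ := max k (S.sup id + 1)

lemma freshVar_notMem (k : ℕ) (S : Finset ℕ) : freshVar k S ∉ S := by
  intro h
  have := Finset.le_sup (f := id) h
  simp only [id, freshVar] at this
  omega

lemma le_freshVar (k : ℕ) (S : Finset ℕ) : k ≤ freshVar k S := le_max_left _ _

/-- Simultaneous capture-avoiding substitution of variables for free variables and of formulas for
propositional symbols. Bound variables are renamed canonically to numbers `≥ k`, so that the
result only depends on the α-equivalence class of the formula. -/
def inst (k : ℕ) (σ : ℕ → ℕ) (s : ℕ → Formula) : Formula → Formula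
  | prop n => s n
  | pred n x xs => pred n (σ x) (xs.map σ)
  | top => top
  | bot => bot
  | and A B => and (inst k σ s A) (inst k σ s B)
  | or A B => or (inst k σ s A) (inst k σ s B)
  | imp A B => imp (inst k σ s A) (inst k σ s B)
  | neg A => neg (inst k σ s A)
  | all x A =>
      all (freshVar k ((A.fv.erase x).image σ))
        (inst k (Function.update σ x (freshVar k ((A.fv.erase x).image σ))) s A)
  | ex x A =>
      ex (freshVar k ((A.fv.erase x).image σ))
        (inst k (Function.update σ x (freshVar k ((A.fv.erase x).image σ))) s A)

lemma inst_congr {k : ℕ} {s : ℕ → Formula} {A : Formula} {σ τ : ℕ → ℕ}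
    (h : ∀ y ∈ A.fv, σ y = τ y) : A.inst k σ s = A.inst k τ s := by
  induction A generalizing σ τ with
  | prop n => rfl
  | top => rfl
  | bot => rfl
  | pred n x xs => simp_all [inst, fv]
  | and A B ihA ihB | or A B ihA ihB | imp A B ihA ihB =>
    simp only [fv, Finset.mem_union] at h
    simp only [inst, ihA fun y hy => h y (.inl hy), ihB fun y hy => h y (.inr hy)]
  | neg A ih => simp only [inst, ih h]
  | all x A ih | ex x A ih =>
    have hS : (A.fv.erase x).image σ = (A.fv.erase x).image τ := Finset.image_congr h
    simp only [inst, hS]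
    congr 1
    apply ih
    intro y hy
    by_cases hyx : y = x
    · simp [hyx]
    · simpa [hyx] using h y (by simp [fv, hyx, hy])

lemma fv_inst {k : ℕ} {σ : ℕ → ℕ} {s : ℕ → Formula} (hs : ∀ n, (s n).Propositional)
    (A : Formula) : (A.inst k σ s).fv = A.fv.image σ := by
  induction A generalizing σ with
  | prop n => simp [inst, fv, (hs n).fv_eq]
  | pred n x xs => ext; simp [inst, fv]
  | all x A ih | ex x A ih =>
    simp only [inst, fv, ih]
    have := freshVar_notMem k ((A.fv.erase x).image σ)
    generalize freshVar k ((A.fv.erase x).image σ) = y at *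
    ext z
    simp only [Finset.mem_erase, Finset.mem_image, Function.update_apply] at *
    grind
  | _ => simp_all [inst, fv, Finset.image_union]

lemma le_of_mem_bv_inst {k : ℕ} {σ : ℕ → ℕ} {s : ℕ → Formula} (hs : ∀ n, (s n).Propositional)
    {A : Formula} {y : ℕ} (hy : y ∈ (A.inst k σ s).bv) : k ≤ y := by
  induction A generalizing σ with
  | prop n => simp [inst, (hs n).bv_eq] at hy
  | and A B ihA ihB | or A B ihA ihB | imp A B ihA ihB =>
    simp only [inst, bv, Finset.mem_union] at hy
    exact hy.elim ihA ihB
  | neg A ih => exact ih hy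
  | all x A ih | ex x A ih =>
    simp only [inst, bv, Finset.mem_insert] at hy
    rcases hy with rfl | hy
    · exact le_freshVar _ _
    · exact ih hy
  | _ => simp [inst, bv] at hy

lemma Propositional.inst {k : ℕ} {σ : ℕ → ℕ} {s : ℕ → Formula} (hs : ∀ n, (s n).Propositional)
    {A : Formula} (h : A.Propositional) : (A.inst k σ s).Propositional := by
  induction A <;> simp_all [Formula.inst, Propositional]

lemma Propositional.inst_prop {k : ℕ} {σ : ℕ → ℕ} {A : Formula} (h : A.Propositional) :
    A.inst k σ prop = A := by
  induction A <;> simp_all [Formula.inst, Propositional]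

lemma propositional_prop (n : ℕ) : (prop n).Propositional := trivial

lemma inst_inst {k m : ℕ} {σ τ : ℕ → ℕ} {s : ℕ → Formula} (hs : ∀ n, (s n).Propositional)
    (A : Formula) : (A.inst k σ s).inst m τ prop = A.inst m (τ ∘ σ) s := by
  induction A generalizing σ τ with
  | prop n => exact (hs n).inst_prop
  | pred n x xs => simp [inst]
  | all x A ih | ex x A ih =>
    have hS : ((A.inst k (Function.update σ x (freshVar k ((A.fv.erase x).image σ))) s).fv.erase
        (freshVar k ((A.fv.erase x).image σ))).image τ = (A.fv.erase x).image (τ ∘ σ) := by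
      have := congrArg (Finset.image τ) (fv_inst (k := k) (σ := σ) hs (all x A))
      simpa only [inst, fv, Finset.image_image] using this
    simp only [inst, hS, ih]
    congr 1
    apply inst_congr
    intro y hy
    have := freshVar_notMem k ((A.fv.erase x).image σ)
    generalize freshVar k ((A.fv.erase x).image σ) = z at *
    simp only [Finset.mem_erase, Finset.mem_image, Function.update_apply, Function.comp] at *
    grind
  | _ => simp_all [inst]

lemma inst_body {k m : ℕ} {σ : ℕ → ℕ} {s : ℕ → Formula} (hs : ∀ n, (s n).Propositional)
    (x d : ℕ) (A : Formula) :
    (A.inst k (Function.update σ x (freshVar k ((A.fv.erase x).image σ))) s).inst m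
      (Function.update id (freshVar k ((A.fv.erase x).image σ)) d) prop =
    A.inst m (Function.update σ x d) s := by
  rw [inst_inst hs]
  apply inst_congr
  intro y hy
  have := freshVar_notMem k ((A.fv.erase x).image σ)
  generalize freshVar k ((A.fv.erase x).image σ) = z at *
  simp only [Finset.mem_erase, Finset.mem_image, Function.update_apply, Function.comp, id] at *
  grind

lemma inst_rename {k x a : ℕ} {σ : ℕ → ℕ} {s : ℕ → Formula} {A : Formula}
    (h : a = x ∨ a ∉ A.bv) :
    (A.rename x a).inst k σ s = A.inst k (Function.update σ x (σ a)) s := by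
  rcases h with rfl | h
  · simp [rename_self]
  induction A generalizing σ with
  | pred n y ys =>
    simp only [rename, inst, List.map_map, Function.update_apply]
    congr 1
    · split_ifs <;> rfl
    · apply List.map_congr_left
      intro z _
      simp only [Function.comp, Function.update_apply]
      split_ifs <;> rfl
  | all z A ih | ex z A ih =>
    by_cases hz : z = x
    · subst hz
      simp only [rename, if_true]
      apply inst_congr
      intro y hy
      simp only [fv, Finset.mem_erase] at hy
      simp [hy.1]
    · simp only [bv, Finset.mem_insert, not_or] at h
      have hS : (((A.rename x a).fv.erase z).image σ) =
          (A.fv.erase z).image (Function.update σ x (σ a)) := by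
        rw [fv_rename h.2]
        ext w
        simp only [Finset.mem_erase, Finset.mem_image, Function.update_apply]
        grind
      simp only [rename, if_neg hz, inst, hS, ih h.2]
      rw [Function.update_of_ne h.1, Function.update_comm hz]
  | _ => simp_all [rename, inst, bv]

end Formula

lemma mem_fvList {Γ : List Formula} {a : ℕ} : a ∈ fvList Γ ↔ ∃ A ∈ Γ, a ∈ A.fv := by
  induction Γ with
  | nil => simp [fvList]
  | cons A Γ ih =>
    have : fvList (A :: Γ) = A.fv ∪ fvList Γ := rfl
    simp [this, ih]

namespace LJPlus

open Formula

variable {Γ Δ : List Formula} {Λ : Option Formula} {A B C : Formula}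

lemma of_axiom {q : Sequent} (r : Rule true true NoLem q []) : LJPlus q :=
  .step r (by simp)

lemma of_unary {q p : Sequent} (r : Rule true true NoLem q [p]) (h : LJPlus p) : LJPlus q :=
  .step r (List.forall_mem_singleton.2 h)

lemma of_binary {q p p' : Sequent} (r : Rule true true NoLem q [p, p']) (h : LJPlus p)
    (h' : LJPlus p') : LJPlus q :=
  .step r (List.forall_mem_cons.2 ⟨h, List.forall_mem_singleton.2 h'⟩)

lemma of_perm_append (h : Γ.Perm Δ) :
    ∀ Θ : List Formula, LJPlus (Θ ++ Γ, Λ) → LJPlus (Θ ++ Δ, Λ) := by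
  induction h with
  | nil => exact fun _ h => h
  | cons A _ ih => intro Θ h; simpa using ih (Θ ++ [A]) (by simpa using h)
  | swap A B Γ => exact fun Θ h => of_unary (.exch _ _ _ _ _) h
  | trans _ _ ih₁ ih₂ => exact fun Θ h => ih₂ Θ (ih₁ Θ h)

lemma of_perm (p : Γ.Perm Δ) (h : LJPlus (Γ, Λ)) : LJPlus (Δ, Λ) := of_perm_append p [] h

lemma append_left (h : LJPlus (Γ, Λ)) : ∀ Δ, LJPlus (Δ ++ Γ, Λ)
  | [] => h
  | A :: Δ => of_unary (.thinL A _ _) (append_left h Δ)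

lemma contract_mem (hA : A ∈ Γ) (h : LJPlus (A :: Γ, Λ)) : LJPlus (Γ, Λ) := by
  have p := List.perm_cons_erase hA
  exact of_perm p.symm (of_unary (.contr A _ _) (of_perm (p.cons A) h))

lemma contract_subset : ∀ {Γ : List Formula}, Γ ⊆ Δ → LJPlus (Γ ++ Δ, Λ) → LJPlus (Δ, Λ)
  | [], _, h => h
  | A :: Γ, hs, h => by
    have hs' := List.cons_subset.1 hs
    exact contract_subset hs'.2 (contract_mem (List.mem_append_right _ hs'.1) h)

lemma weaken (h : LJPlus (Γ, Λ)) (hs : Γ ⊆ Δ) : LJPlus (Δ, Λ) :=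
  contract_subset hs (of_perm List.perm_append_comm (append_left h Δ))

lemma hyp (h : A ∈ Γ) : LJPlus (Γ, some A) :=
  weaken (of_axiom (.ax A)) (by simpa using h)

lemma cut (h : LJPlus (Γ, some C)) (h' : LJPlus (C :: Γ, Λ)) : LJPlus (Γ, Λ) :=
  weaken (of_binary (.cut' _ _ _ _ rfl) h h') (by simp)

lemma impL (h : LJPlus (Γ, some A)) (h' : LJPlus (B :: Γ, Λ)) :
    LJPlus (A.imp B :: Γ, Λ) :=
  weaken (of_binary (.impL _ _ _ _ _) h h') (by simp)

lemma exFalso (h : LJPlus (Γ, none)) : LJPlus (Γ, Λ) :=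
  match Λ with
  | none => h
  | some A => of_unary (.thinR A Γ) h

lemma negL (h : LJPlus (Γ, some A)) : LJPlus (A.neg :: Γ, Λ) :=
  exFalso (of_unary (.negL A Γ) h)

lemma exists_fresh (S : Finset ℕ) : ∃ c, c ∉ S := Infinite.exists_notMem_finset S

lemma interderivable_of_inst_eq (A : Formula) : ∀ B : Formula,
    A.inst 0 id prop = B.inst 0 id prop → LJPlus ([A], some B) ∧ LJPlus ([B], some A) := by
  induction hn : A.size using Nat.strong_induction_on generalizing A with
  | _ n IH =>
  subst hn
  intro B h
  have quant : ∀ (x z c : ℕ) (A' B' : Formula), A'.size < A.size →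
      freshVar 0 ((A'.fv.erase x).image id) = freshVar 0 ((B'.fv.erase z).image id) →
      A'.inst 0 (Function.update id x (freshVar 0 ((A'.fv.erase x).image id))) prop =
      B'.inst 0 (Function.update id z (freshVar 0 ((B'.fv.erase z).image id))) prop →
      c ∉ A'.vars ∪ B'.vars → LJPlus ([A'.rename x c], some (B'.rename z c)) ∧
        LJPlus ([B'.rename z c], some (A'.rename x c)) := by
    intro x z c A' B' hsz hy hb hc
    simp only [Finset.mem_union, not_or] at hc
    refine IH _ hsz _ (size_rename _ _ _) _ ?_
    rw [inst_rename (.inr fun h => hc.1 (bv_subset_vars _ h)),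
      inst_rename (.inr fun h => hc.2 (bv_subset_vars _ h)), id,
      ← inst_body (k := 0) (σ := id) propositional_prop x,
      ← inst_body (k := 0) (σ := id) propositional_prop z, hb, hy]
  cases A with
  | all x A =>
    cases B with
    | all z B =>
      simp only [inst, Formula.all.injEq] at h
      obtain ⟨c, hc⟩ := exists_fresh (A.vars ∪ B.vars ∪ (all x A).fv ∪ (all z B).fv)
      simp only [Finset.mem_union, not_or] at hc
      obtain ⟨h₁, h₂⟩ := quant x z c A B (by simp [size]) h.1 h.2 (by simp [hc])
      refine ⟨of_unary (.allR _ z c B ?_ hc.1.1.2) (of_unary (.allL _ _ c _ _ ?_) h₁),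
        of_unary (.allR _ x c A ?_ hc.1.1.1) (of_unary (.allL _ _ c _ _ ?_) h₂)⟩
      · simp [mem_fvList, hc]
      · exact .inr fun h => hc.1.1.1 (bv_subset_vars _ h)
      · simp [mem_fvList, hc]
      · exact .inr fun h => hc.1.1.2 (bv_subset_vars _ h)
    | _ => simp [inst] at h
  | ex x A =>
    cases B with
    | ex z B =>
      simp only [inst, Formula.ex.injEq] at h
      obtain ⟨c, hc⟩ := exists_fresh (A.vars ∪ B.vars ∪ (ex x A).fv ∪ (ex z B).fv)
      simp only [Finset.mem_union, not_or] at hc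
      obtain ⟨h₁, h₂⟩ := quant x z c A B (by simp [size]) h.1 h.2 (by simp [hc])
      refine ⟨of_unary (.exL x A c _ _ ?_ hc.1.1.1) (of_unary (.exR _ _ _ c ?_) h₁),
        of_unary (.exL z B c _ _ ?_ hc.1.1.2) (of_unary (.exR _ _ _ c ?_) h₂)⟩
      · simp [fvList, fvOpt, hc]
      · exact .inr fun h => hc.1.1.2 (bv_subset_vars _ h)
      · simp [fvList, fvOpt, hc]
      · exact .inr fun h => hc.1.1.1 (bv_subset_vars _ h)
    | _ => simp [inst] at h
  | and A A' =>
    cases B with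
    | and B B' =>
      simp only [inst, Formula.and.injEq] at h
      obtain ⟨h₁, h₂⟩ := IH A.size (by grind [size]) A rfl B h.1
      obtain ⟨h₁', h₂'⟩ := IH A'.size (by grind [size]) A' rfl B' h.2
      exact ⟨of_binary (.andR _ _ _) (of_unary (.andL1 _ _ _ _) h₁)
          (of_unary (.andL2 _ _ _ _) h₁'),
        of_binary (.andR _ _ _) (of_unary (.andL1 _ _ _ _) h₂) (of_unary (.andL2 _ _ _ _) h₂')⟩
    | _ => simp [inst] at h
  | or A A' =>
    cases B with
    | or B B' =>
      simp only [inst, Formula.or.injEq] at h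
      obtain ⟨h₁, h₂⟩ := IH A.size (by grind [size]) A rfl B h.1
      obtain ⟨h₁', h₂'⟩ := IH A'.size (by grind [size]) A' rfl B' h.2
      exact ⟨of_binary (.orL _ _ _ _) (of_unary (.orR1 _ _ _) h₁) (of_unary (.orR2 _ _ _) h₁'),
        of_binary (.orL _ _ _ _) (of_unary (.orR1 _ _ _) h₂) (of_unary (.orR2 _ _ _) h₂')⟩
    | _ => simp [inst] at h
  | imp A A' =>
    cases B with
    | imp B B' =>
      simp only [inst, Formula.imp.injEq] at h
      obtain ⟨h₁, h₂⟩ := IH A.size (by grind [size]) A rfl B h.1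
      obtain ⟨h₁', h₂'⟩ := IH A'.size (by grind [size]) A' rfl B' h.2
      exact ⟨of_unary (.impR _ _ _)
          (of_perm (.swap _ _ _) (impL h₂ (weaken h₁' (by simp)))),
        of_unary (.impR _ _ _) (of_perm (.swap _ _ _) (impL h₁ (weaken h₂' (by simp))))⟩
    | _ => simp [inst] at h
  | neg A =>
    cases B with
    | neg B =>
      simp only [inst, Formula.neg.injEq] at h
      obtain ⟨h₁, h₂⟩ := IH A.size (by simp [size]) A rfl B h
      exact ⟨of_unary (.negR _ _) (of_perm (.swap _ _ _) (negL h₂)),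
        of_unary (.negR _ _) (of_perm (.swap _ _ _) (negL h₁))⟩
    | _ => simp [inst] at h
  | _ => cases B <;> simp_all [inst, hyp]

lemma of_inst_eq (h : A.inst 0 id prop = B.inst 0 id prop) (hA : LJPlus (Γ, some A)) :
    LJPlus (Γ, some B) :=
  cut hA (weaken (interderivable_of_inst_eq A B h).1 (by simp))

lemma of_inst_eq_left (h : A.inst 0 id prop = B.inst 0 id prop) (hA : LJPlus (A :: Γ, Λ)) :
    LJPlus (B :: Γ, Λ) :=
  cut (weaken (interderivable_of_inst_eq A B h).2 (by simp)) (weaken hA (by grind))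

lemma inst_inst_id (k x d : ℕ) (B : Formula) :
    (B.inst k (Function.update id x d) prop).inst 0 id prop =
      B.inst 0 (Function.update id x d) prop := by
  rw [inst_inst propositional_prop, Function.id_comp]

lemma inst_id_rename {x c : ℕ} (h : c = x ∨ c ∉ B.bv) :
    (B.rename x c).inst 0 id prop = B.inst 0 (Function.update id x c) prop :=
  inst_rename h

lemma allR {x : ℕ} (S : Finset ℕ)
    (h : ∀ c ∉ S, LJPlus (Γ, some (B.inst 0 (Function.update id x c) prop))) :
    LJPlus (Γ, some (all x B)) := by
  obtain ⟨c, hc⟩ := exists_fresh (S ∪ B.vars ∪ (fvList Γ ∪ (all x B).fv))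
  simp only [Finset.mem_union, not_or] at hc
  refine of_unary (.allR Γ x c B (by simp [hc]) hc.1.2) (of_inst_eq ?_ (h c hc.1.1))
  rw [inst_inst_id, inst_id_rename (.inr fun h => hc.1.2 (bv_subset_vars _ h))]

lemma exL {x : ℕ} (S : Finset ℕ)
    (h : ∀ c ∉ S, LJPlus (B.inst 0 (Function.update id x c) prop :: Γ, Λ)) :
    LJPlus (ex x B :: Γ, Λ) := by
  obtain ⟨c, hc⟩ := exists_fresh (S ∪ B.vars ∪ ((fvList Γ ∪ (ex x B).fv) ∪ fvOpt Λ))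
  simp only [Finset.mem_union, not_or] at hc
  refine of_unary (.exL x B c Γ Λ (by simp [hc]) hc.1.2) (of_inst_eq_left ?_ (h c hc.1.1))
  rw [inst_inst_id, inst_id_rename (.inr fun h => hc.1.2 (bv_subset_vars _ h))]

/-- Canonical renaming of bound variables to numbers above `d` makes `d` substitutable by `rename`. -/
lemma inst_succ_body (x d : ℕ) (B : Formula) :
    ((B.inst (d + 1) (Function.update id x (freshVar (d + 1) ((B.fv.erase x).image id)))
      prop).rename (freshVar (d + 1) ((B.fv.erase x).image id)) d).inst 0 id prop =
    B.inst 0 (Function.update id x d) prop := by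
  rw [inst_id_rename, inst_body propositional_prop]
  exact .inr fun h => absurd (le_of_mem_bv_inst propositional_prop h) (by omega)

lemma allL {x : ℕ} (d : ℕ) (h : LJPlus (B.inst 0 (Function.update id x d) prop :: Γ, Λ)) :
    LJPlus (all x B :: Γ, Λ) := by
  apply of_inst_eq_left (A := (all x B).inst (d + 1) id prop)
  · rw [inst_inst propositional_prop, Function.id_comp]
  refine of_unary (.allL _ _ d _ _ ?_) (of_inst_eq_left ?_ h)
  · exact .inr fun h => absurd (le_of_mem_bv_inst propositional_prop h) (by omega)
  · rw [inst_inst_id, inst_succ_body]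

lemma exR {x : ℕ} (d : ℕ) (h : LJPlus (Γ, some (B.inst 0 (Function.update id x d) prop))) :
    LJPlus (Γ, some (ex x B)) := by
  apply of_inst_eq (A := (ex x B).inst (d + 1) id prop)
  · rw [inst_inst propositional_prop, Function.id_comp]
  refine of_unary (.exR _ _ _ d ?_) (of_inst_eq ?_ h)
  · exact .inr fun h => absurd (le_of_mem_bv_inst propositional_prop h) (by omega)
  · rw [inst_inst_id, inst_succ_body]

variable {s t : ℕ → Formula}

lemma map_inst_update {k a c : ℕ} {σ : ℕ → ℕ} (ha : a ∉ fvList Γ) :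
    Γ.map (inst k (Function.update σ a c) s) = Γ.map (inst k σ s) := by
  apply List.map_congr_left
  intro A hA
  apply inst_congr
  intro y hy
  rw [Function.update_of_ne]
  rintro rfl
  exact ha (mem_fvList.2 ⟨A, hA, hy⟩)

lemma inst_rename_update {k x a c : ℕ} {σ : ℕ → ℕ} (ha : a ∉ A.vars) :
    (A.rename x a).inst k (Function.update σ a c) s = A.inst k (Function.update σ x c) s := by
  rw [inst_rename (.inr fun h => ha (bv_subset_vars _ h)), Function.update_self]
  apply inst_congr
  intro y hy
  have : y ≠ a := by rintro rfl; exact ha (fv_subset_vars _ hy)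
  simp only [Function.update_apply, if_neg this]

/-- Derivability is closed under substitution. -/
theorem map_inst (hs : ∀ n, (s n).Propositional) {q : Sequent} (h : LJPlus q) :
    ∀ σ : ℕ → ℕ, LJPlus (q.1.map (inst 0 σ s), q.2.map (inst 0 σ s)) := by
  unfold LJPlus at h
  induction h with
  | step r _ ih =>
  intro σ
  cases r with
  | ax A => exact of_axiom (.ax _)
  | topR => exact of_axiom .topR
  | botL => exact of_axiom .botL
  | lemAx A h => exact h.elim
  | thinL A Γ Λ => exact of_unary (.thinL _ _ _) (ih _ List.mem_cons_self σ :)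
  | thinR A Γ => exact of_unary (.thinR _ _) (ih _ List.mem_cons_self σ :)
  | contr A Γ Λ => exact of_unary (.contr _ _ _) (ih _ List.mem_cons_self σ :)
  | exch Δ Γ A B Λ =>
    have := ih _ List.mem_cons_self σ
    simp only [List.map_append, List.map_cons] at this ⊢
    exact of_unary (.exch _ _ _ _ _) this
  | cut' Γ Δ C Λ hc =>
    simp only [List.map_append]
    exact of_binary (.cut' _ _ (C.inst 0 σ s) _ rfl) (ih (Γ, some C) (by simp) σ)
      (ih (C :: Δ, Λ) (by simp) σ)
  | andR Γ A B =>
    exact of_binary (.andR _ _ _) (ih (Γ, some A) (by simp) σ) (ih (Γ, some B) (by simp) σ)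
  | andL1 A B Γ Λ => exact of_unary (.andL1 _ _ _ _) (ih _ List.mem_cons_self σ :)
  | andL2 A B Γ Λ => exact of_unary (.andL2 _ _ _ _) (ih _ List.mem_cons_self σ :)
  | orL A B Γ Λ =>
    exact of_binary (.orL _ _ _ _) (ih (A :: Γ, Λ) (by simp) σ) (ih (B :: Γ, Λ) (by simp) σ)
  | orR1 Γ A B => exact of_unary (.orR1 _ _ _) (ih _ List.mem_cons_self σ :)
  | orR2 Γ A B => exact of_unary (.orR2 _ _ _) (ih _ List.mem_cons_self σ :)
  | negR A Γ => exact of_unary (.negR _ _) (ih _ List.mem_cons_self σ :)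
  | negL A Γ => exact of_unary (.negL _ _) (ih _ List.mem_cons_self σ :)
  | impR A B Γ => exact of_unary (.impR _ _ _) (ih _ List.mem_cons_self σ :)
  | impL A B Γ Δ Λ =>
    simp only [List.map_append, List.map_cons]
    exact of_binary (.impL _ _ _ _ _) (ih (Γ, some A) (by simp) σ) (ih (B :: Δ, Λ) (by simp) σ)
  | allR Γ x a G ha hv =>
    refine allR ∅ fun c _ => ?_
    have := ih _ List.mem_cons_self (Function.update σ a c)
    simp only [Finset.mem_union, not_or] at ha
    rw [inst_body hs]
    simpa only [Option.map_some, map_inst_update ha.1, inst_rename_update hv] using this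
  | allL x G a Γ Λ hc =>
    refine allL (σ a) ?_
    rw [inst_body hs, ← inst_rename hc]
    exact ih _ List.mem_cons_self σ
  | exR Γ x G a hc =>
    refine exR (σ a) ?_
    rw [inst_body hs, ← inst_rename hc]
    exact ih _ List.mem_cons_self σ
  | exL x G a Γ Λ ha hv =>
    refine exL ∅ fun c _ => ?_
    have := ih _ List.mem_cons_self (Function.update σ a c)
    simp only [Finset.mem_union, not_or] at ha
    have hΛ : Λ.map (inst 0 (Function.update σ a c) s) = Λ.map (inst 0 σ s) := by
      cases Λ with
      | none => rfl
      | some A =>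
        refine congrArg some (inst_congr fun y hy => Function.update_of_ne ?_ _ _)
        rintro rfl
        exact ha.2 hy
    rw [inst_body hs]
    simpa only [List.map_cons, hΛ, map_inst_update ha.1.1, inst_rename_update hv] using this
  | neut' N Γ Λ hn hN =>
    exact of_binary (.neut' (N.inst 0 σ s) _ _ rfl (hN.inst hs))
      (ih (N :: Γ, Λ) (by simp) σ) (ih (N.neg :: Γ, Λ) (by simp) σ)

/-- Monotonicity of substitution for propositional symbols with respect to polarity. -/
lemma inst_mono (A : Formula) (Γ : List Formula) (σ : ℕ → ℕ)
    (hs : ∀ n, (s n).Propositional) (ht : ∀ n, (t n).Propositional)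
    (hpos : ∀ n ∈ polProps true A, LJPlus (s n :: Γ, some (t n)))
    (hneg : ∀ n ∈ polProps false A, LJPlus (t n :: Γ, some (s n))) :
    LJPlus (A.inst 0 σ s :: Γ, some (A.inst 0 σ t)) := by
  induction A generalizing s t σ with
  | prop n => exact hpos n (by simp [polProps])
  | pred | top | bot => exact hyp (by simp [inst])
  | and A B ihA ihB =>
    simp only [polProps, Finset.mem_union] at hpos hneg
    exact of_binary (.andR _ _ _)
      (of_unary (.andL1 _ _ _ _) (ihA σ hs ht (fun n h => hpos n (.inl h))
        fun n h => hneg n (.inl h)))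
      (of_unary (.andL2 _ _ _ _) (ihB σ hs ht (fun n h => hpos n (.inr h))
        fun n h => hneg n (.inr h)))
  | or A B ihA ihB =>
    simp only [polProps, Finset.mem_union] at hpos hneg
    exact of_binary (.orL _ _ _ _)
      (of_unary (.orR1 _ _ _) (ihA σ hs ht (fun n h => hpos n (.inl h))
        fun n h => hneg n (.inl h)))
      (of_unary (.orR2 _ _ _) (ihB σ hs ht (fun n h => hpos n (.inr h))
        fun n h => hneg n (.inr h)))
  | imp A B ihA ihB =>
    simp only [polProps, Finset.mem_union, Bool.not_true, Bool.not_false] at hpos hneg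
    have hA := ihA σ ht hs (fun n h => hneg n (.inl h)) fun n h => hpos n (.inl h)
    have hB := ihB σ hs ht (fun n h => hpos n (.inr h)) fun n h => hneg n (.inr h)
    exact of_unary (.impR _ _ _)
      (of_perm (.swap _ _ _) (impL hA (weaken hB (by simp))))
  | neg A ih =>
    exact of_unary (.negR _ _) (of_perm (.swap _ _ _) (negL (ih σ ht hs hneg hpos)))
  | all x A ih =>
    refine allR ∅ fun c _ => allL c ?_
    rw [inst_body hs, inst_body ht]
    exact ih _ hs ht hpos hneg
  | ex x A ih =>
    refine exL ∅ fun c _ => exR c ?_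
    rw [inst_body hs, inst_body ht]
    exact ih _ hs ht hpos hneg

end LJPlus

/-- The truth constant assigned to a propositional symbol by a truth assignment. -/
def truthConst (v : ℕ → Bool) (n : ℕ) : Formula := if v n then .top else .bot

lemma propositional_truthConst (v : ℕ → Bool) (n : ℕ) : (truthConst v n).Propositional := by
  unfold truthConst
  split_ifs <;> trivial

/-- The Aczel–Kleene slash relative to a truth assignment `v` for the propositional symbols, where
`σ` assigns variables, viewed as terms, to the free variables. -/
def Slash (v : ℕ → Bool) : (ℕ → ℕ) → Formula → Prop
  | _, .prop n => v n = true
  | σ, .pred n x xs => LJPlusThm ((Formula.pred n x xs).inst 0 σ (truthConst v))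
  | _, .top => True
  | _, .bot => False
  | σ, .and A B => Slash v σ A ∧ Slash v σ B
  | σ, .or A B => Slash v σ A ∨ Slash v σ B
  | σ, .imp A B =>
      LJPlusThm ((A.imp B).inst 0 σ (truthConst v)) ∧ (Slash v σ A → Slash v σ B)
  | σ, .neg A => LJPlusThm (A.neg.inst 0 σ (truthConst v)) ∧ ¬ Slash v σ A
  | σ, .all x A =>
      LJPlusThm ((Formula.all x A).inst 0 σ (truthConst v)) ∧
        ∀ d, Slash v (Function.update σ x d) A
  | σ, .ex x A => ∃ d, Slash v (Function.update σ x d) A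

namespace Slash

open Formula LJPlus

variable {v : ℕ → Bool} {σ τ : ℕ → ℕ} {A : Formula}

lemma congr (h : ∀ y ∈ A.fv, σ y = τ y) : Slash v σ A ↔ Slash v τ A := by
  induction A generalizing σ τ with
  | prop | top | bot => rfl
  | pred n x xs => simp only [Slash, inst_congr h]
  | and A B ihA ihB | or A B ihA ihB | imp A B ihA ihB =>
    have hA := ihA fun y hy => h y (Finset.mem_union_left _ hy)
    have hB := ihB fun y hy => h y (Finset.mem_union_right _ hy)
    simp only [Slash, hA, hB, inst_congr h]
  | neg A ih => simp only [Slash, ih h, inst_congr h]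
  | all x A ih | ex x A ih =>
    have hA (d : ℕ) : Slash v (Function.update σ x d) A ↔ Slash v (Function.update τ x d) A := by
      apply ih
      intro y hy
      by_cases hyx : y = x
      · simp [hyx]
      · simpa [hyx] using h y (by simp [fv, hyx, hy])
    simp only [Slash, hA, inst_congr h]

lemma rename_iff {x a : ℕ} (h : a = x ∨ a ∉ A.bv) :
    Slash v σ (A.rename x a) ↔ Slash v (Function.update σ x (σ a)) A := by
  rcases h with rfl | h
  · simp [rename_self]
  induction A generalizing σ with
  | prop | top | bot => rfl
  | pred n y ys => exact iff_of_eq (congrArg LJPlusThm (inst_rename (.inr h)))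
  | and A B ihA ihB | or A B ihA ihB | imp A B ihA ihB =>
    have hT := inst_rename (k := 0) (σ := σ) (s := truthConst v) (.inr h : a = x ∨ _)
    simp only [bv, Finset.mem_union, not_or] at h
    simp only [rename] at hT ⊢
    simp only [Slash, ihA h.1, ihB h.2, hT]
  | neg A ih =>
    have hT := inst_rename (k := 0) (σ := σ) (s := truthConst v) (.inr h : a = x ∨ _)
    simp only [rename] at hT ⊢
    simp only [Slash, ih h, hT]
  | all z A ih | ex z A ih =>
    by_cases hz : z = x
    · subst hz
      simp only [rename, if_true]
      apply congr
      intro y hy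
      simp only [fv, Finset.mem_erase] at hy
      simp [hy.1]
    · have hT := inst_rename (k := 0) (σ := σ) (s := truthConst v) (.inr h : a = x ∨ _)
      simp only [bv, Finset.mem_insert, not_or] at h
      simp only [rename, if_neg hz] at hT ⊢
      simp only [Slash, ih h.2, hT, Function.update_of_ne h.1, Function.update_comm hz]

lemma rename_update_iff {x a c : ℕ} (ha : a ∉ A.vars) :
    Slash v (Function.update σ a c) (A.rename x a) ↔ Slash v (Function.update σ x c) A := by
  rw [rename_iff (.inr fun h => ha (bv_subset_vars _ h)), Function.update_self]
  apply congr
  intro y hy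
  have : y ≠ a := by rintro rfl; exact ha (fv_subset_vars _ hy)
  simp only [Function.update_apply, if_neg this]

lemma update_iff_of_notMem {Γ : List Formula} {a c : ℕ} (ha : a ∉ fvList Γ) (hA : A ∈ Γ) :
    Slash v (Function.update σ a c) A ↔ Slash v σ A := by
  apply congr
  intro y hy
  rw [Function.update_of_ne]
  rintro rfl
  exact ha (mem_fvList.2 ⟨A, hA, hy⟩)

lemma provable (h : Slash v σ A) : LJPlusThm (A.inst 0 σ (truthConst v)) := by
  induction A generalizing σ with
  | prop n =>
    have h : v n = true := h
    simp only [inst, truthConst, h, if_true]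
    exact of_axiom .topR
  | top => exact of_axiom .topR
  | bot => exact h.elim
  | pred => exact h
  | and A B ihA ihB => exact of_binary (.andR _ _ _) (ihA h.1) (ihB h.2)
  | or A B ihA ihB =>
    exact h.elim (fun h => of_unary (.orR1 _ _ _) (ihA h)) fun h => of_unary (.orR2 _ _ _) (ihB h)
  | imp | neg | all => exact h.1
  | ex x A ih =>
    obtain ⟨d, h⟩ := h
    refine exR d ?_
    rw [inst_body (propositional_truthConst v)]
    exact ih h

lemma or_neg_provable (hA : A.Propositional) :
    Slash v σ A ∨ ¬ Slash v σ A ∧ LJPlusThm (A.neg.inst 0 σ (truthConst v)) := by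
  have negI {B : Formula} (h : LJPlus ([B], none)) : LJPlusThm B.neg :=
    of_unary (.negR _ _) h
  have negE {B : Formula} (h : LJPlusThm B.neg) : LJPlus ([B], none) :=
    LJPlus.cut (weaken h (by simp)) (negL (hyp (by simp)))
  induction A with
  | pred | all | ex => exact hA.elim
  | prop n =>
    by_cases h : v n = true
    · exact .inl h
    · refine .inr ⟨h, negI ?_⟩
      simp only [inst, truthConst, h]
      exact of_axiom .botL
  | top => exact .inl trivial
  | bot => exact .inr ⟨id, negI (of_axiom .botL)⟩
  | and A B ihA ihB =>
    rcases ihA hA.1 with h | ⟨h, hn⟩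
    · rcases ihB hA.2 with h' | ⟨h', hn⟩
      · exact .inl ⟨h, h'⟩
      · exact .inr ⟨fun h => h' h.2, negI (of_unary (.andL2 _ _ _ _) (negE hn))⟩
    · exact .inr ⟨fun h' => h h'.1, negI (of_unary (.andL1 _ _ _ _) (negE hn))⟩
  | or A B ihA ihB =>
    rcases ihA hA.1 with h | ⟨h, hn⟩
    · exact .inl (.inl h)
    · rcases ihB hA.2 with h' | ⟨h', hn'⟩
      · exact .inl (.inr h')
      · exact .inr ⟨not_or.2 ⟨h, h'⟩, negI (of_binary (.orL _ _ _ _) (negE hn) (negE hn'))⟩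
  | imp A B ihA ihB =>
    rcases ihB hA.2 with h' | ⟨h', hn'⟩
    · exact .inl ⟨of_unary (.impR _ _ _) (weaken (provable h') (by simp)), fun _ => h'⟩
    · rcases ihA hA.1 with h | ⟨h, hn⟩
      · exact .inr ⟨fun hi => h' (hi.2 h), negI (impL (provable h) (negE hn'))⟩
      · exact .inl ⟨of_unary (.impR _ _ _) (exFalso (negE hn)), fun h' => (h h').elim⟩
  | neg A ih =>
    rcases ih hA with h | ⟨h, hn⟩
    · exact .inr ⟨fun hn => hn.2 h, negI (negL (provable h))⟩
    · exact .inl ⟨hn, h⟩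

lemma provable_of_forall {Γ : List Formula} {B : Formula} (h : LJPlus (Γ, some B))
    (hΓ : ∀ A ∈ Γ, Slash v σ A) : LJPlusThm (B.inst 0 σ (truthConst v)) := by
  replace h := map_inst (propositional_truthConst v) h σ
  simp only [Option.map_some] at h
  generalize B.inst 0 σ (truthConst v) = C at h
  induction Γ with
  | nil => exact h
  | cons A Γ ih =>
    simp only [List.forall_mem_cons] at hΓ
    exact ih hΓ.2 (LJPlus.cut (weaken (provable hΓ.1) (by simp)) h)

/-- Every derivable sequent is true under the slash interpretation. -/
theorem sound {q : Sequent} (h : LJPlus q) :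
    ∀ σ : ℕ → ℕ, (∀ A ∈ q.1, Slash v σ A) → ∃ B, q.2 = some B ∧ Slash v σ B := by
  unfold LJPlus at h
  induction h with
  | step r hp ih =>
  have hq := Derives.step r hp
  intro σ hΓ
  cases r with
  | ax A => exact ⟨A, rfl, hΓ A (by simp)⟩
  | topR => exact ⟨_, rfl, trivial⟩
  | botL => exact (hΓ .bot (by simp)).elim
  | lemAx A h => exact h.elim
  | thinL A Γ Λ => exact ih _ List.mem_cons_self σ fun B hB => hΓ B (by simp_all)
  | thinR A Γ =>
    obtain ⟨B, hB, -⟩ := ih _ List.mem_cons_self σ hΓ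
    simp at hB
  | contr A Γ Λ => exact ih _ List.mem_cons_self σ fun B hB => hΓ B (by simp_all)
  | exch Δ Γ A B Λ => exact ih _ List.mem_cons_self σ fun C hC => hΓ C (by grind)
  | cut' Γ Δ C Λ hc =>
    simp only [List.forall_mem_cons, List.forall_mem_append, List.not_mem_nil,
      IsEmpty.forall_iff, implies_true, and_true] at ih hΓ
    obtain ⟨B, hB, h⟩ := ih.1 σ hΓ.1
    cases hB
    exact ih.2 σ ⟨h, hΓ.2⟩
  | andR Γ A B =>
    simp only [List.forall_mem_cons, List.not_mem_nil, IsEmpty.forall_iff, implies_true,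
      and_true, Option.some.injEq,
      exists_eq_left'] at ih ⊢
    exact ⟨ih.1 σ hΓ, ih.2 σ hΓ⟩
  | andL1 A B Γ Λ =>
    simp only [List.forall_mem_cons, List.not_mem_nil, IsEmpty.forall_iff, implies_true,
      and_true] at ih hΓ
    exact ih σ ⟨hΓ.1.1, hΓ.2⟩
  | andL2 A B Γ Λ =>
    simp only [List.forall_mem_cons, List.not_mem_nil, IsEmpty.forall_iff, implies_true,
      and_true] at ih hΓ
    exact ih σ ⟨hΓ.1.2, hΓ.2⟩
  | orL A B Γ Λ =>
    simp only [List.forall_mem_cons, List.not_mem_nil, IsEmpty.forall_iff, implies_true,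
      and_true] at ih hΓ
    exact hΓ.1.elim (fun h => ih.1 σ ⟨h, hΓ.2⟩) fun h => ih.2 σ ⟨h, hΓ.2⟩
  | orR1 Γ A B =>
    simp only [List.forall_mem_cons, List.not_mem_nil, IsEmpty.forall_iff, implies_true,
      and_true, Option.some.injEq,
      exists_eq_left'] at ih ⊢
    exact .inl (ih σ hΓ)
  | orR2 Γ A B =>
    simp only [List.forall_mem_cons, List.not_mem_nil, IsEmpty.forall_iff, implies_true,
      and_true, Option.some.injEq,
      exists_eq_left'] at ih ⊢
    exact .inr (ih σ hΓ)
  | negR A Γ =>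
    simp only [List.forall_mem_cons, List.not_mem_nil, IsEmpty.forall_iff, implies_true,
      and_true] at ih
    refine ⟨_, rfl, provable_of_forall hq hΓ, fun h => ?_⟩
    obtain ⟨B, hB, -⟩ := ih σ ⟨h, hΓ⟩
    simp at hB
  | negL A Γ =>
    simp only [List.forall_mem_cons, List.not_mem_nil, IsEmpty.forall_iff, implies_true,
      and_true, Option.some.injEq,
      exists_eq_left'] at ih hΓ
    exact (hΓ.1.2 (ih σ hΓ.2)).elim
  | impR A B Γ =>
    simp only [List.forall_mem_cons, List.not_mem_nil, IsEmpty.forall_iff, implies_true,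
      and_true, Option.some.injEq,
      exists_eq_left'] at ih
    exact ⟨_, rfl, provable_of_forall hq hΓ, fun h => ih σ ⟨h, hΓ⟩⟩
  | impL A B Γ Δ Λ =>
    simp only [List.forall_mem_cons, List.forall_mem_append, List.not_mem_nil,
      IsEmpty.forall_iff, implies_true, and_true] at ih hΓ
    obtain ⟨C, hC, h⟩ := ih.1 σ hΓ.2.1
    cases hC
    exact ih.2 σ ⟨hΓ.1.2 h, hΓ.2.2⟩
  | allR Γ x a G ha hv =>
    simp only [List.forall_mem_cons, List.not_mem_nil, IsEmpty.forall_iff, implies_true,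
      and_true, Option.some.injEq,
      exists_eq_left'] at ih
    simp only [Finset.mem_union, not_or] at ha
    refine ⟨_, rfl, provable_of_forall hq hΓ, fun d => (rename_update_iff hv).1 ?_⟩
    exact ih _ fun A hA => (update_iff_of_notMem ha.1 hA).2 (hΓ A hA)
  | allL x G a Γ Λ hc =>
    simp only [List.forall_mem_cons, List.not_mem_nil, IsEmpty.forall_iff, implies_true,
      and_true] at ih hΓ
    exact ih σ ⟨(rename_iff hc).2 (hΓ.1.2 _), hΓ.2⟩
  | exR Γ x G a hc =>
    simp only [List.forall_mem_cons, List.not_mem_nil, IsEmpty.forall_iff, implies_true,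
      and_true, Option.some.injEq,
      exists_eq_left'] at ih
    exact ⟨_, rfl, _, (rename_iff hc).1 (ih σ hΓ)⟩
  | exL x G a Γ Λ ha hv =>
    simp only [List.forall_mem_cons, List.not_mem_nil, IsEmpty.forall_iff, implies_true,
      and_true] at ih hΓ
    simp only [Finset.mem_union, not_or] at ha
    obtain ⟨⟨d, hd⟩, hΓ⟩ := hΓ
    obtain ⟨B, rfl, hB⟩ := ih (Function.update σ a d) ⟨(rename_update_iff hv).2 hd,
      fun A hA => (update_iff_of_notMem ha.1.1 hA).2 (hΓ A hA)⟩
    have hB' : a ∉ fvList [B] := by simpa [fvList, fvOpt] using ha.2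
    exact ⟨B, rfl, (update_iff_of_notMem hB' (by simp)).1 hB⟩
  | neut' N Γ Λ hn hN =>
    simp only [List.forall_mem_cons, List.not_mem_nil, IsEmpty.forall_iff, implies_true,
      and_true] at ih
    rcases or_neg_provable (v := v) (σ := σ) hN with h | ⟨h, hT⟩
    · exact ih.1 σ ⟨h, hΓ⟩
    · exact ih.2 σ ⟨⟨hT, h⟩, hΓ⟩

end Slash

/-- The literal on the propositional symbol `n` that is true under `v`. -/
def literal (v : ℕ → Bool) (n : ℕ) : Formula := if v n then .prop n else .neg (.prop n)

namespace LJPlus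

open Formula

/-- Derivability follows from derivability under every choice of literals. -/
lemma of_forall_literals {Λ : Option Formula} : ∀ {L : List ℕ}, L.Nodup →
    (∀ v, LJPlus (L.map (literal v), Λ)) → LJPlus ([], Λ) := by
  intro L hL h
  induction L with
  | nil => exact h fun _ => true
  | cons n L ih =>
    rw [List.nodup_cons] at hL
    refine ih hL.2 fun v => ?_
    have key (b : Bool) :
        LJPlus ((if b then prop n else (prop n).neg) :: L.map (literal v), Λ) := by
      have hv := h (Function.update v n b)
      have hL' : L.map (literal (Function.update v n b)) = L.map (literal v) := by
        apply List.map_congr_left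
        intro m hm
        have : m ≠ n := by rintro rfl; exact hL.1 hm
        simp [literal, this]
      rw [List.map_cons, hL'] at hv
      simpa [literal] using hv
    exact of_binary (.neut' (prop n) _ _ rfl trivial) (by simpa using key true)
      (by simpa using key false)

lemma thm_of_forall_inst {A : Formula} (h : ∀ v, LJPlusThm (A.inst 0 id (truthConst v))) :
    LJPlusThm A := by
  suffices LJPlusThm (A.inst 0 id prop) from
    of_inst_eq (by rw [inst_inst propositional_prop, Function.id_comp]) this
  refine of_forall_literals A.propSyms.nodup_toList fun v =>
    cut (weaken (h v) (by simp)) (inst_mono A _ id (propositional_truthConst v)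
      propositional_prop (fun n hn => ?_) fun n hn => ?_)
  · have hmem : literal v n ∈ A.propSyms.toList.map (literal v) :=
      List.mem_map_of_mem (by simp [propSyms, hn])
    by_cases hv : v n = true
    · simp only [literal, hv, if_true] at hmem
      exact hyp (List.mem_cons_of_mem _ hmem)
    · simp only [truthConst, hv]
      exact exFalso (weaken (of_axiom .botL) (by simp))
  · have hmem : literal v n ∈ A.propSyms.toList.map (literal v) :=
      List.mem_map_of_mem (by simp [propSyms, hn])
    by_cases hv : v n = true
    · simp only [truthConst, hv, if_true]
      exact weaken (of_axiom .topR) (by simp)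
    · simp only [literal, hv] at hmem
      exact cut (hyp (List.mem_cons_of_mem _ hmem)) (negL (hyp (by simp)))

lemma inst_truthConst_mono {A : Formula} {u v : ℕ → Bool}
    (hpos : ∀ n ∈ polProps true A, u n = true → v n = true)
    (hneg : ∀ n ∈ polProps false A, v n = true → u n = true)
    (h : LJPlusThm (A.inst 0 id (truthConst u))) : LJPlusThm (A.inst 0 id (truthConst v)) := by
  have aux {u v : ℕ → Bool} {n : ℕ} (h : u n = true → v n = true) :
      LJPlus ([truthConst u n], some (truthConst v n)) := by
    by_cases hv : v n = true
    · simp only [truthConst, hv, if_true]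
      exact weaken (of_axiom .topR) (by simp)
    · have hu : ¬ u n = true := fun hu => hv (h hu)
      simp only [truthConst, hu]
      exact exFalso (of_axiom .botL)
  exact cut h (inst_mono A [] id (propositional_truthConst u) (propositional_truthConst v)
    (fun n hn => aux (hpos n hn)) fun n hn => aux (hneg n hn))

theorem disjunction_property {F G : Formula} (h : LJPlusThm (F.or G))
    (hFG : ∀ n : ℕ, n ∈ F.propSyms → n ∈ G.propSyms →
      ¬ (n ∈ polProps true (F.or G) ∧ n ∈ polProps false (F.or G))) :
    LJPlusThm F ∨ LJPlusThm G := by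
  by_contra hcon
  rw [not_or] at hcon
  obtain ⟨v, hv⟩ := not_forall.1 (mt thm_of_forall_inst hcon.1)
  obtain ⟨w, hw⟩ := not_forall.1 (mt thm_of_forall_inst hcon.2)
  let u : ℕ → Bool := fun n =>
    if n ∉ F.propSyms then w n
    else if n ∉ G.propSyms then v n
    else if n ∈ polProps true (F.or G) then v n && w n else v n || w n
  simp only [propSyms, polProps, Finset.mem_union] at hFG
  obtain ⟨B, hB, hs⟩ := Slash.sound (v := u) h id (by simp)
  cases hB
  rcases hs with hs | hs
  · refine hv (inst_truthConst_mono (fun n hn => ?_) (fun n hn => ?_) hs.provable) <;>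
      (have := hFG n; simp only [u, propSyms, polProps, Finset.mem_union]) <;>
      split_ifs <;> grind
  · refine hw (inst_truthConst_mono (fun n hn => ?_) (fun n hn => ?_) hs.provable) <;>
      (have := hFG n; simp only [u, propSyms, polProps, Finset.mem_union]) <;>
      split_ifs <;> grind

end LJPlus

/-- disjunction property for disjuncts with disjoint propositional
symbols, and more generally when every shared propositional symbol occurs with
only one polarity in F ∨ G. -/
theorem ljplus_disjunction_property :
    (∀ F G : Formula, LJPlusThm (F.or G) →
      Disjoint F.propSyms G.propSyms →
      LJPlusThm F ∨ LJPlusThm G) ∧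
    (∀ F G : Formula, LJPlusThm (F.or G) →
      (∀ n : ℕ, n ∈ F.propSyms → n ∈ G.propSyms →
        ¬ (n ∈ Formula.polProps true (F.or G) ∧ n ∈ Formula.polProps false (F.or G))) →
      LJPlusThm F ∨ LJPlusThm G) := by
  refine ⟨fun F G h hFG => LJPlus.disjunction_property h fun n hF hG => ?_,
    fun F G h hFG => LJPlus.disjunction_property h hFG⟩
  exact (Finset.disjoint_left.1 hFG hF hG).elim
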